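/- arXiv:2409.04550 — 2 statements merged into one kernel-verified Lean document; each statement's English description precedes it below -/
import Mathlib

section
/- Let c > 0 and let d be a positive integer. Then there exists a real polynomial p_d of degree at most d such that max_{x∈[-1,1]} |f(x) − p_d(x)| ≤ (12/d)(c/π)^4 if c ≥ 2π, and max_{x∈[-1,1]} |f(x) − p_d(x)| ≤ (40/d)(c/π)^2 if 0 < c < 2π, where f(x) = (1/4)·1/(1 + exp(c x)). -/
open Real Polynomial

lemma abs_sub_sub_deriv_mul_le {f f' : ℝ → ℝ} {K : ℝ} (hf : ∀ x, HasDerivAt f (f' x) x)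
    (hf' : ∀ x y, |f' y - f' x| ≤ K * |y - x|) (x y : ℝ) :
    |f y - f x - f' x * (y - x)| ≤ K * (y - x) ^ 2 := by
  have hK : 0 ≤ K := by simpa using (abs_nonneg _).trans (hf' 0 1)
  have hderiv : ∀ z ∈ Set.uIcc x y, HasDerivWithinAt (fun z => f z - f' x * z)
      (f' z - f' x) (Set.uIcc x y) z := fun z _ => by
    simpa using ((hf z).fun_sub ((hasDerivAt_id z).const_mul (f' x))).hasDerivWithinAt
  have hbound : ∀ z ∈ Set.uIcc x y, ‖f' z - f' x‖ ≤ K * |y - x| := fun z hz =>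
    (hf' x z).trans (mul_le_mul_of_nonneg_left (Set.abs_sub_left_of_mem_uIcc hz) hK)
  have h := Convex.norm_image_sub_le_of_norm_hasDerivWithin_le hderiv hbound
    (convex_uIcc x y) Set.left_mem_uIcc Set.right_mem_uIcc
  rw [Real.norm_eq_abs, Real.norm_eq_abs, mul_assoc, abs_mul_abs_self] at h
  calc |f y - f x - f' x * (y - x)| = |f y - f' x * y - (f x - f' x * x)| := by ring_nf
    _ ≤ K * (y - x) ^ 2 := by rwa [sq]

lemma abs_sigmoid_sub_le (x y : ℝ) : |sigmoid y - sigmoid x| ≤ |y - x| := by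
  have h := Convex.norm_image_sub_le_of_norm_hasDerivWithin_le (C := 1)
    (fun z _ => (hasDerivAt_sigmoid z).hasDerivWithinAt) (fun z _ => ?_) convex_univ
    (Set.mem_univ x) (Set.mem_univ y)
  · simpa using h
  · have h0 := sigmoid_nonneg z
    have h1 := sigmoid_le_one z
    rw [Real.norm_eq_abs, abs_le]
    constructor <;> nlinarith

lemma abs_sigmoid_sub_sub_le (x y : ℝ) :
    |sigmoid y - sigmoid x - sigmoid x * (1 - sigmoid x) * (y - x)| ≤ (y - x) ^ 2 := by
  have h := abs_sub_sub_deriv_mul_le (K := 1) hasDerivAt_sigmoid (fun a b => ?_) x y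
  · simpa using h
  · have hfac : sigmoid b * (1 - sigmoid b) - sigmoid a * (1 - sigmoid a)
        = (1 - sigmoid a - sigmoid b) * (sigmoid b - sigmoid a) := by ring
    rw [hfac, abs_mul]
    refine mul_le_mul ?_ (abs_sigmoid_sub_le a b) (abs_nonneg _) zero_le_one
    have := sigmoid_nonneg a
    have := sigmoid_le_one a
    have := sigmoid_nonneg b
    have := sigmoid_le_one b
    rw [abs_le]
    constructor <;> linarith

lemma natDegree_bernsteinPolynomial_le (n k : ℕ) :
    (bernsteinPolynomial ℝ n k).natDegree ≤ n := by
  obtain h | h := lt_or_ge n k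
  · simp [bernsteinPolynomial.eq_zero_of_lt ℝ h]
  · have h1 : (1 - X : ℝ[X]).natDegree ≤ 1 := by compute_degree
    have h2 : ((1 - X : ℝ[X]) ^ (n - k)).natDegree ≤ (n - k) * 1 := natDegree_pow_le_of_le _ h1
    have h3 : ((n.choose k : ℝ[X]) * X ^ k).natDegree ≤ k := by compute_degree
    exact (natDegree_mul_le_of_le h3 h2).trans (by omega)

/-- Bernstein approximation of a function with a quadratic Taylor remainder bound. -/
lemma abs_sub_sum_bernstein_le {f f' : ℝ → ℝ} {K t : ℝ} {n : ℕ} (hn : 0 < n)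
    (hf : ∀ y, |f y - f t - f' t * (y - t)| ≤ K * (y - t) ^ 2) (ht : t ∈ Set.Icc (0 : ℝ) 1) :
    |f t - ∑ k ∈ Finset.range (n + 1), f (k / n) * (bernsteinPolynomial ℝ n k).eval t|
      ≤ K * (t * (1 - t) / n) := by
  have hn' : (n : ℝ) ≠ 0 := by positivity
  set b : ℕ → ℝ := fun k => (bernsteinPolynomial ℝ n k).eval t
  have hb : ∀ k, 0 ≤ b k := fun k => by
    have h0 := ht.1
    have h1 : 0 ≤ 1 - t := sub_nonneg.2 ht.2
    simp only [b, bernsteinPolynomial, eval_mul, eval_natCast, eval_pow, eval_X, eval_sub, eval_one]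
    positivity
  have hsum : ∑ k ∈ Finset.range (n + 1), b k = 1 := by
    simpa [eval_finsetSum] using congrArg (eval t) (bernsteinPolynomial.sum ℝ n)
  have hmean : ∑ k ∈ Finset.range (n + 1), k * b k = n * t := by
    simpa [eval_finsetSum] using congrArg (eval t) (bernsteinPolynomial.sum_smul ℝ n)
  have hvar : ∑ k ∈ Finset.range (n + 1), (n * t - k) ^ 2 * b k = n * t * (1 - t) := by
    simpa [eval_finsetSum] using congrArg (eval t) (bernsteinPolynomial.variance ℝ n)
  have hmean' : ∑ k ∈ Finset.range (n + 1), ((k / n : ℝ) - t) * b k = 0 := by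
    calc _ = (∑ k ∈ Finset.range (n + 1), k * b k) / n
          - t * ∑ k ∈ Finset.range (n + 1), b k := by
          rw [Finset.sum_div, Finset.mul_sum, ← Finset.sum_sub_distrib]
          exact Finset.sum_congr rfl fun k _ => by ring
      _ = 0 := by rw [hmean, hsum]; field_simp; ring
  have hvar' : ∑ k ∈ Finset.range (n + 1), ((k / n : ℝ) - t) ^ 2 * b k = t * (1 - t) / n := by
    calc _ = (∑ k ∈ Finset.range (n + 1), (n * t - k) ^ 2 * b k) / n ^ 2 := by
          rw [Finset.sum_div]
          exact Finset.sum_congr rfl fun k _ => by field_simp; ring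
      _ = t * (1 - t) / n := by rw [hvar]; field_simp
  have herr : f t - ∑ k ∈ Finset.range (n + 1), f (k / n) * b k
      = -∑ k ∈ Finset.range (n + 1), (f (k / n) - f t - f' t * (k / n - t)) * b k := by
    have : ∑ k ∈ Finset.range (n + 1), (f (k / n) - f t - f' t * (k / n - t)) * b k
        = ∑ k ∈ Finset.range (n + 1), f (k / n) * b k
          - f t * ∑ k ∈ Finset.range (n + 1), b k
          - f' t * ∑ k ∈ Finset.range (n + 1), ((k / n : ℝ) - t) * b k := by
      rw [Finset.mul_sum, Finset.mul_sum, ← Finset.sum_sub_distrib, ← Finset.sum_sub_distrib]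
      exact Finset.sum_congr rfl fun k _ => by ring
    rw [this, hsum, hmean']
    ring
  rw [herr, abs_neg, ← hvar', Finset.mul_sum]
  refine (Finset.abs_sum_le_sum_abs _ _).trans (Finset.sum_le_sum fun k _ => ?_)
  rw [abs_mul, abs_of_nonneg (hb k), ← mul_assoc]
  exact mul_le_mul_of_nonneg_right (hf _) (hb k)

lemma exists_poly_abs_fermi_dirac_sub_le (c : ℝ) {d : ℕ} (hd : 0 < d) :
    ∃ p : ℝ[X], p.natDegree ≤ d ∧ ∀ x ∈ Set.Icc (-1 : ℝ) 1,
      |(1 / 4) * (1 / (1 + Real.exp (c * x))) - p.eval x| ≤ c ^ 2 / (4 * d) := by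
  set g : ℝ → ℝ := fun t => (1 / 4) * sigmoid (-c * (2 * t - 1))
  set g' : ℝ → ℝ := fun t => -c / 2 *
    (sigmoid (-c * (2 * t - 1)) * (1 - sigmoid (-c * (2 * t - 1))))
  have hg : ∀ t y, |g y - g t - g' t * (y - t)| ≤ c ^ 2 * (y - t) ^ 2 := fun t y => by
    have h := abs_sigmoid_sub_sub_le (-c * (2 * t - 1)) (-c * (2 * y - 1))
    calc |g y - g t - g' t * (y - t)| = |1 / 4 * (sigmoid (-c * (2 * y - 1))
          - sigmoid (-c * (2 * t - 1)) - sigmoid (-c * (2 * t - 1))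
            * (1 - sigmoid (-c * (2 * t - 1))) * (-c * (2 * y - 1) - -c * (2 * t - 1)))| := by
          simp only [g, g']; ring_nf
      _ ≤ 1 / 4 * (-c * (2 * y - 1) - -c * (2 * t - 1)) ^ 2 := by
          rw [abs_mul, abs_of_pos (by norm_num : (0 : ℝ) < 1 / 4)]
          exact mul_le_mul_of_nonneg_left h (by norm_num)
      _ = c ^ 2 * (y - t) ^ 2 := by ring
  refine ⟨(∑ k ∈ Finset.range (d + 1), C (g (k / d)) * bernsteinPolynomial ℝ d k).comp
    (C (1 / 2) * (X + 1)), ?_, fun x hx => ?_⟩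
  · have hlin : (C (1 / 2) * (X + 1) : ℝ[X]).natDegree ≤ 1 := by compute_degree
    have hsum : (∑ k ∈ Finset.range (d + 1),
        C (g (k / d)) * bernsteinPolynomial ℝ d k).natDegree ≤ d :=
      natDegree_sum_le_of_forall_le _ _ fun k _ =>
        (natDegree_C_mul_le _ _).trans (natDegree_bernsteinPolynomial_le d k)
    exact natDegree_comp_le.trans ((Nat.mul_le_mul hsum hlin).trans_eq (mul_one d))
  · have ht : 1 / 2 * (x + 1) ∈ Set.Icc (0 : ℝ) 1 :=
      ⟨by linarith [hx.1], by linarith [hx.2]⟩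
    have h := abs_sub_sum_bernstein_le hd (hg (1 / 2 * (x + 1))) ht
    have hgx : g (1 / 2 * (x + 1)) = (1 / 4) * (1 / (1 + Real.exp (c * x))) := by
      simp only [g, sigmoid_def, one_div]
      ring_nf
    rw [hgx] at h
    simp only [eval_comp, eval_finsetSum, eval_mul, eval_C, eval_add, eval_X, eval_one]
    refine h.trans ?_
    have hd' : (0 : ℝ) < d := by exact_mod_cast hd
    have hquarter : 1 / 2 * (x + 1) * (1 - 1 / 2 * (x + 1)) ≤ 1 / 4 := by nlinarith [sq_nonneg x]
    calc c ^ 2 * (1 / 2 * (x + 1) * (1 - 1 / 2 * (x + 1)) / d) ≤ c ^ 2 * (1 / 4 / d) := by gcongr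
      _ = c ^ 2 / (4 * d) := by field_simp

/-- For `c > 0` and a positive integer `d`, there is a real polynomial `p` of
degree at most `d` approximating the quarter Fermi-Dirac function
`f(x) = (1/4) / (1 + exp (c x))` on `[-1,1]`, with error at most `(12/d)(c/π)^4` when
`c ≥ 2π`, and at most `(40/d)(c/π)^2` when `0 < c < 2π`. -/
theorem fermi_dirac_poly_approx (c : ℝ) (hc : 0 < c) (d : ℕ) (hd : 0 < d) :
    ∃ p : Polynomial ℝ, p.natDegree ≤ d ∧
      (2 * π ≤ c →
        ∀ x ∈ Set.Icc (-1 : ℝ) 1,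
          |(1 / 4) * (1 / (1 + Real.exp (c * x))) - p.eval x| ≤ (12 / d) * (c / π) ^ 4) ∧
      (c < 2 * π →
        ∀ x ∈ Set.Icc (-1 : ℝ) 1,
          |(1 / 4) * (1 / (1 + Real.exp (c * x))) - p.eval x| ≤ (40 / d) * (c / π) ^ 2) := by
  obtain ⟨p, hp, h⟩ := exists_poly_abs_fermi_dirac_sub_le c hd
  have hd' : (0 : ℝ) < d := by exact_mod_cast hd
  have hπ : π ^ 2 < 16 := by nlinarith [pi_pos, pi_lt_four]
  have hsmall : c ^ 2 / (4 * d) ≤ (40 / d) * (c / π) ^ 2 := by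
    rw [div_pow, div_mul_div_comm, div_le_div_iff₀ (by positivity) (by positivity)]
    nlinarith [mul_pos hd' (pow_pos hc 2)]
  refine ⟨p, hp, fun hc2 x hx => (h x hx).trans (hsmall.trans ?_), fun _ x hx =>
    (h x hx).trans hsmall⟩
  have hr : 2 ≤ c / π := (le_div_iff₀ pi_pos).2 hc2
  have hr2 : 4 ≤ (c / π) ^ 2 := by nlinarith
  rw [div_mul_eq_mul_div, div_mul_eq_mul_div]
  refine div_le_div_of_nonneg_right ?_ hd'.le
  nlinarith
end

section
/- Let L ≥ 1 be an integer and set ε_k = 2cos(πk/(L+2)) for k = 1,…,L+1. Then for every m ∈ {1,…,L}, ε_m − ε_{m+1} ≥ (2π/(L+2))·sin(π/(L+2)); in particular every gap between consecutive eigenvalues of the path-graph adjacency matrix on L+1 vertices is at least (2π/(L+2))·sin(π/(L+2)), which is Ω(1/(L+2)²). -/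
open Real

theorem sin_le_sin_of_mem_Icc_pi_sub {θ c : ℝ} (hθ : 0 ≤ θ) (hc : c ∈ Set.Icc θ (π - θ)) :
    sin θ ≤ sin c := by
  obtain ⟨h1, h2⟩ := hc
  rcases le_total c (π / 2) with h | h
  · exact sin_le_sin_of_le_of_le_pi_div_two (by linarith [pi_pos]) h h1
  · rw [← sin_pi_sub c]
    exact sin_le_sin_of_le_of_le_pi_div_two (by linarith [pi_pos]) (by linarith) (by linarith)

theorem mul_sin_le_cos_sub_cos {θ a b : ℝ} (hθ : 0 ≤ θ) (ha : θ ≤ a) (hab : a < b)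
    (hb : b ≤ π - θ) : (b - a) * sin θ ≤ cos a - cos b := by
  obtain ⟨c, hc, h⟩ := exists_hasDerivAt_eq_slope cos (fun x => -sin x) hab
    continuous_cos.continuousOn (fun x _ => hasDerivAt_cos x)
  have hs := sin_le_sin_of_mem_Icc_pi_sub hθ ⟨ha.trans hc.1.le, hc.2.le.trans hb⟩
  rw [eq_div_iff (sub_pos.2 hab).ne'] at h
  linarith [mul_le_mul_of_nonneg_left hs (sub_pos.2 hab).le]

/-- For `L ≥ 1` and `ε_k = 2 cos(π k/(L+2))`, every gap between consecutive
eigenvalues of the path-graph adjacency matrix satisfies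
`ε_m − ε_{m+1} ≥ (2π/(L+2))·sin(π/(L+2))` for all `m ∈ {1, …, L}`. -/
theorem path_eigenvalue_gap (L : ℕ) (hL : 1 ≤ L) (m : ℕ) (hm1 : 1 ≤ m) (hmL : m ≤ L) :
    (2 * π / (L + 2)) * Real.sin (π / (L + 2)) ≤
      2 * Real.cos (π * m / (L + 2)) - 2 * Real.cos (π * (m + 1) / (L + 2)) := by
  have h1 : (1 : ℝ) ≤ m := by exact_mod_cast hm1
  have h2 : (m : ℝ) ≤ L := by exact_mod_cast hmL
  have hθ : 0 < π / ((L : ℝ) + 2) := by positivity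
  have hπ : π / ((L : ℝ) + 2) * (L + 2) = π := by field_simp
  rw [mul_div_assoc, mul_div_right_comm π (m : ℝ), mul_div_right_comm π ((m : ℝ) + 1)]
  generalize π / ((L : ℝ) + 2) = θ at *
  have h := mul_sin_le_cos_sub_cos (a := θ * m) (b := θ * (m + 1)) hθ.le
    (by nlinarith) (by nlinarith) (by nlinarith)
  linarith
end
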